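/- arXiv:2003.10935 — 3 statements merged into one kernel-verified Lean document; each statement's English description precedes it below -/
import Mathlib

section
/- Let V = V1 ⊎ V2 be a finite set partitioned into two parts, let A be a family of binary relations on V with every relation contained in V1² ∪ V2², and assume the Gaifman graph of A restricted to V1 and the Gaifman graph of A restricted to V2 are both connected. Let c be a coarsest coherent configuration refining A. Then every colour class of c is either contained in V1² ∪ V2² (plain) or contained in the set of crossing pairs (V1 × V2) ∪ (V2 × V1), and for every crossing colour class R there are diagonal colours d1, d2 of c such that R = {(u,v) ∈ (V1 × V2) ∪ (V2 × V1) : c(u,u) = d1 and c(v,v) = d2}. -/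
/-- `c : V × V → K` is a coherent configuration with intersection numbers `q`:
(i) a colour is diagonal or off-diagonal consistently, (ii) the converse colour is
well defined, (iii) the number of `(b,d)`-triangles over a pair depends only on its colour. -/
def IsCoherentWith {V K : Type} (c : V × V → K) (q : K × K × K → ℕ) : Prop :=
  (∀ u v u' v' : V, c (u, v) = c (u', v') → (u = v ↔ u' = v')) ∧
  (∀ u v u' v' : V, c (u, v) = c (u', v') → c (v, u) = c (v', u')) ∧
  (∀ (a b d : K) (u v : V), c (u, v) = a →
    {w : V | c (u, w) = b ∧ c (w, v) = d}.ncard = q (a, b, d))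

/-- `c` is a coherent configuration. -/
def IsCoherent {V K : Type} (c : V × V → K) : Prop :=
  ∃ q : K × K × K → ℕ, IsCoherentWith c q

/-- The class of a colour `a`. -/
def colourClass {V K : Type} (c : V × V → K) (a : K) : Set (V × V) := {p | c p = a}

/-- A colour is attained if it lies in the image of `c`. -/
def Attained {V K : Type} (c : V × V → K) (a : K) : Prop := a ∈ Set.range c

/-- A colour is diagonal if its class is contained in the diagonal. -/
def IsDiagonal {V K : Type} (c : V × V → K) (a : K) : Prop :=
  ∀ p ∈ colourClass c a, p.1 = p.2

/-- `c` refines a family `A` of binary relations: every colour class is contained in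
or disjoint from each relation in `A`. -/
def RefinesFamily {V K : Type} (c : V × V → K) (A : Set (Set (V × V))) : Prop :=
  ∀ a : K, ∀ E ∈ A, colourClass c a ⊆ E ∨ Disjoint (colourClass c a) E

/-- `c'` refines `c`: every colour class of `c'` is contained in some colour class of `c`. -/
def RefinesColouring {V K K' : Type} (c' : V × V → K') (c : V × V → K) : Prop :=
  ∀ p p' : V × V, c' p = c' p' → c p = c p'

/-- `c` is a coarsest coherent configuration refining `A`. -/
def IsCoarsest {V K : Type} (c : V × V → K) (A : Set (Set (V × V))) : Prop :=
  IsCoherent c ∧ RefinesFamily c A ∧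
  ∀ (K' : Type) (c' : V × V → K'), IsCoherent c' → RefinesFamily c' A →
    RefinesColouring c' c

/-- `S` is a strongly connected component of the binary relation `R`: an
inclusion-maximal set such that any two of its members are joined by an `R`-path
of length at least `1`. -/
def IsSCC {V : Type} (R : Set (V × V)) (S : Set V) : Prop :=
  (∀ u ∈ S, ∀ v ∈ S, Relation.TransGen (fun x y => (x, y) ∈ R) u v) ∧
  ∀ T : Set V, S ⊆ T →
    (∀ u ∈ T, ∀ v ∈ T, Relation.TransGen (fun x y => (x, y) ∈ R) u v) → T = S

/-- `E` is a union of colour classes of `c`. -/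
def IsUnionOfClasses {V K : Type} (c : V × V → K) (E : Set (V × V)) : Prop :=
  ∀ p p' : V × V, c p = c p' → p ∈ E → p' ∈ E

/-- Composition of binary relations. -/
def relComp {V : Type} (R S : Set (V × V)) : Set (V × V) :=
  {p | ∃ v, (p.1, v) ∈ R ∧ (v, p.2) ∈ S}

/-- The Gaifman graph of the family `A` restricted to `U` is connected. -/
def GaifmanConnected {V : Type} (A : Set (Set (V × V))) (U : Set V) : Prop :=
  U.Nonempty ∧ ∀ u ∈ U, ∀ v ∈ U,
    Relation.ReflTransGen
      (fun x y => x ∈ U ∧ y ∈ U ∧ ∃ E ∈ A, (x, y) ∈ E ∨ (y, x) ∈ E) u v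

/-- In a coherent configuration, equally coloured pairs admit a colour-preserving bijection of
third vertices. -/
theorem IsCoherent.exists_perm {V K : Type} [Finite V] {c : V × V → K} (hc : IsCoherent c)
    {u v u' v' : V} (h : c (u, v) = c (u', v')) :
    ∃ σ : Equiv.Perm V, ∀ w, c (u', σ w) = c (u, w) ∧ c (σ w, v') = c (w, v) := by
  obtain ⟨q, -, -, hq⟩ := hc
  let f : V → K × K := fun w => (c (u, w), c (w, v))
  let g : V → K × K := fun w => (c (u', w), c (w, v'))
  have key : ∀ k : K × K, Nonempty ({w // f w = k} ≃ {w // g w = k}) := by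
    rintro ⟨b, d⟩
    have e : {w : V | f w = (b, d)}.ncard = {w : V | g w = (b, d)}.ncard := by
      simp only [f, g, Prod.mk.injEq]
      rw [hq _ b d u v rfl, hq _ b d u' v' rfl, h]
    exact Finite.card_eq.mp e
  refine ⟨Equiv.ofFiberEquiv fun k => (key k).some, fun w => ?_⟩
  have := Equiv.ofFiberEquiv_map (fun k => (key k).some) w
  exact Prod.mk.inj this

/-- A colouring is coherent as soon as equally coloured pairs admit colour-preserving
bijections of third vertices. -/
theorem IsCoherent.of_exists_perm {V K : Type} {c : V × V → K}
    (hdiag : ∀ u v u' v' : V, c (u, v) = c (u', v') → (u = v ↔ u' = v'))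
    (hswap : ∀ u v u' v' : V, c (u, v) = c (u', v') → c (v, u) = c (v', u'))
    (hperm : ∀ u v u' v' : V, c (u, v) = c (u', v') →
      ∃ σ : Equiv.Perm V, ∀ w, c (u', σ w) = c (u, w) ∧ c (σ w, v') = c (w, v)) :
    IsCoherent c := by
  classical
  refine ⟨fun t => if h : ∃ p, c p = t.1 then
    {w : V | c (h.choose.1, w) = t.2.1 ∧ c (w, h.choose.2) = t.2.2}.ncard else 0,
    hdiag, hswap, fun a b d u v huv => ?_⟩
  have h : ∃ p, c p = a := ⟨_, huv⟩
  simp only [dif_pos h]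
  obtain ⟨σ, hσ⟩ := hperm u v h.choose.1 h.choose.2 (huv.trans h.choose_spec.symm)
  refine Set.ncard_congr' (σ.subtypeEquiv fun w => ?_)
  simp [hσ w]

/-- The colour of a pair determines the diagonal colour of its first endpoint. -/
theorem IsCoherent.diag_left {V K : Type} [Finite V] {c : V × V → K} (hc : IsCoherent c)
    {u v u' v' : V} (h : c (u, v) = c (u', v')) : c (u, u) = c (u', u') := by
  obtain ⟨σ, hσ⟩ := hc.exists_perm h
  have hu := (hσ u).1
  obtain ⟨q, hdiag, -, -⟩ := hc
  have : u' = σ u := (hdiag _ _ _ _ hu).mpr rfl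
  rw [← this] at hu
  exact hu.symm

/-- The colour of a pair determines the diagonal colour of its second endpoint. -/
theorem IsCoherent.diag_right {V K : Type} [Finite V] {c : V × V → K} (hc : IsCoherent c)
    {u v u' v' : V} (h : c (u, v) = c (u', v')) : c (v, v) = c (v', v') := by
  have hs : c (v, u) = c (v', u') := by
    obtain ⟨q, -, hswap, -⟩ := hc
    exact hswap _ _ _ _ h
  exact hc.diag_left hs

/-- Reachability along a relation that is invariant under a coherent configuration is invariant
as well. -/
theorem IsCoherent.reflTransGen_congr {V K : Type} [Finite V] {c : V × V → K}
    (hc : IsCoherent c) {S : V → V → Prop}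
    (hS : ∀ u v u' v', c (u, v) = c (u', v') → S u v → S u' v') {u v u' v' : V}
    (h : c (u, v) = c (u', v')) (huv : Relation.ReflTransGen S u v) :
    Relation.ReflTransGen S u' v' := by
  induction huv generalizing v' with
  | refl =>
    obtain ⟨q, hdiag, -, -⟩ := hc
    rw [(hdiag _ _ _ _ h).mp rfl]
  | tail _ hbc ih =>
    obtain ⟨σ, hσ⟩ := hc.exists_perm h
    exact (ih (hσ _).1.symm).tail (hS _ _ _ _ (hσ _).2.symm hbc)

/-- A coherent configuration refining a family of relations distinguishes pairs inside the parts
from pairs across the parts, provided the parts are the connected components of the family. -/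
theorem IsCoherent.plain_congr {V K : Type} [Finite V] {V1 : Set V} {A : Set (Set (V × V))}
    (hA : ∀ E ∈ A, E ⊆ {p : V × V | p.1 ∈ V1 ↔ p.2 ∈ V1})
    (h1 : GaifmanConnected A V1) (h2 : GaifmanConnected A V1ᶜ)
    {c : V × V → K} (hc : IsCoherent c) (hcA : RefinesFamily c A) {u v u' v' : V}
    (h : c (u, v) = c (u', v')) : (u ∈ V1 ↔ v ∈ V1) ↔ (u' ∈ V1 ↔ v' ∈ V1) := by
  let S : V → V → Prop := fun x y => ∃ E ∈ A, (x, y) ∈ E ∨ (y, x) ∈ E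
  have hmem : ∀ E ∈ A, ∀ p p', c p = c p' → p ∈ E → p' ∈ E := by
    intro E hE p p' hpp hp
    rcases hcA (c p) E hE with hsub | hdis
    · exact hsub hpp.symm
    · exact (Set.disjoint_left.mp hdis rfl hp).elim
  have hS : ∀ u v u' v', c (u, v) = c (u', v') → S u v → S u' v' := by
    rintro u v u' v' h ⟨E, hE, hp | hp⟩
    · exact ⟨E, hE, Or.inl (hmem E hE _ _ h hp)⟩
    · obtain ⟨q, -, hswap, -⟩ := hc
      exact ⟨E, hE, Or.inr (hmem E hE _ _ (hswap _ _ _ _ h) hp)⟩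
  have hreach : ∀ x y, (x ∈ V1 ↔ y ∈ V1) ↔ Relation.ReflTransGen S x y := by
    intro x y
    constructor
    · intro hxy
      by_cases hx : x ∈ V1
      · exact Relation.ReflTransGen.mono (fun _ _ h => h.2.2) _ _ (h1.2 x hx y (hxy.mp hx))
      · exact Relation.ReflTransGen.mono (fun _ _ h => h.2.2) _ _
          (h2.2 x hx y fun hy => hx (hxy.mpr hy))
    · intro hxy
      induction hxy with
      | refl => rfl
      | tail _ hbc ih =>
        obtain ⟨E, hE, hp | hp⟩ := hbc
        · exact ih.trans (hA E hE hp)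
        · exact ih.trans (hA E hE hp).symm
  rw [hreach, hreach]
  exact ⟨hc.reflTransGen_congr hS h, hc.reflTransGen_congr hS h.symm⟩

open Classical in
/-- The colouring that agrees with `c` inside the parts `V1`, `V1ᶜ` and colours each crossing pair
by the diagonal colours of its endpoints. -/
noncomputable def mergeCrossing {V K : Type} (V1 : Set V) (c : V × V → K) (p : V × V) :
    K ⊕ K × K :=
  if p.1 ∈ V1 ↔ p.2 ∈ V1 then Sum.inl (c p) else Sum.inr (c (p.1, p.1), c (p.2, p.2))

theorem mergeCrossing_eq_iff {V K : Type} {V1 : Set V} {c : V × V → K} {u v u' v' : V} :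
    mergeCrossing V1 c (u, v) = mergeCrossing V1 c (u', v') ↔
      ((u ∈ V1 ↔ v ∈ V1) ∧ (u' ∈ V1 ↔ v' ∈ V1) ∧ c (u, v) = c (u', v')) ∨
      (¬(u ∈ V1 ↔ v ∈ V1) ∧ ¬(u' ∈ V1 ↔ v' ∈ V1) ∧
        c (u, u) = c (u', u') ∧ c (v, v) = c (v', v')) := by
  by_cases h : (u ∈ V1 ↔ v ∈ V1) <;> by_cases h' : (u' ∈ V1 ↔ v' ∈ V1) <;>
    simp [mergeCrossing, h, h']

theorem mergeCrossing_congr {V K : Type} [Finite V] {V1 : Set V} {c : V × V → K}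
    (hc : IsCoherent c)
    (hplain : ∀ u v u' v', c (u, v) = c (u', v') →
      ((u ∈ V1 ↔ v ∈ V1) ↔ (u' ∈ V1 ↔ v' ∈ V1)))
    {u v u' v' : V} (h : c (u, v) = c (u', v')) :
    mergeCrossing V1 c (u, v) = mergeCrossing V1 c (u', v') := by
  have hp := hplain _ _ _ _ h
  rw [mergeCrossing_eq_iff]
  by_cases huv : u ∈ V1 ↔ v ∈ V1
  · exact Or.inl ⟨huv, hp.mp huv, h⟩
  · exact Or.inr ⟨huv, fun h' => huv (hp.mpr h'), hc.diag_left h, hc.diag_right h⟩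

/-- Merging crossing colours with the same endpoint colours preserves coherence. -/
theorem IsCoherent.mergeCrossing {V K : Type} [Finite V] {V1 : Set V} {c : V × V → K}
    (hc : IsCoherent c)
    (hplain : ∀ u v u' v', c (u, v) = c (u', v') →
      ((u ∈ V1 ↔ v ∈ V1) ↔ (u' ∈ V1 ↔ v' ∈ V1))) :
    IsCoherent (mergeCrossing V1 c) := by
  classical
  obtain ⟨hdiag, hswap⟩ : (∀ u v u' v' : V, c (u, v) = c (u', v') → (u = v ↔ u' = v')) ∧
      (∀ u v u' v' : V, c (u, v) = c (u', v') → c (v, u) = c (v', u')) := by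
    obtain ⟨q, h, h', -⟩ := hc
    exact ⟨h, h'⟩
  refine IsCoherent.of_exists_perm ?_ ?_ ?_
  · intro u v u' v' h
    rcases mergeCrossing_eq_iff.mp h with ⟨-, -, h⟩ | ⟨h, h', -, -⟩
    · exact hdiag _ _ _ _ h
    · exact iff_of_false (fun e => h (by rw [e])) (fun e => h' (by rw [e]))
  · intro u v u' v' h
    rw [mergeCrossing_eq_iff]
    rcases mergeCrossing_eq_iff.mp h with ⟨h1, h2, h⟩ | ⟨h1, h2, h3, h4⟩
    · exact Or.inl ⟨h1.symm, h2.symm, hswap _ _ _ _ h⟩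
    · exact Or.inr ⟨fun h => h1 h.symm, fun h => h2 h.symm, h4, h3⟩
  · intro u v u' v' h
    rcases mergeCrossing_eq_iff.mp h with ⟨-, -, h⟩ | ⟨hn, hn', hu, hv⟩
    · obtain ⟨σ, hσ⟩ := hc.exists_perm h
      exact ⟨σ, fun w => ⟨mergeCrossing_congr hc hplain (hσ w).1,
        mergeCrossing_congr hc hplain (hσ w).2⟩⟩
    · obtain ⟨σ, hσ⟩ := hc.exists_perm hu
      obtain ⟨τ, hτ⟩ := hc.exists_perm hv
      have hσp : ∀ w, (u' ∈ V1 ↔ σ w ∈ V1) ↔ (u ∈ V1 ↔ w ∈ V1) :=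
        fun w => hplain _ _ _ _ (hσ w).1
      have hτp : ∀ w, (τ w ∈ V1 ↔ v' ∈ V1) ↔ (w ∈ V1 ↔ v ∈ V1) :=
        fun w => hplain _ _ _ _ (hτ w).2
      -- glue `σ` on the part of `u` with `τ` on the part of `v`
      let ρ : V → V := fun w => if u ∈ V1 ↔ w ∈ V1 then σ w else τ w
      have hρ : Function.Injective ρ := by
        intro x y hxy
        have hdisj : ∀ x y, (u ∈ V1 ↔ x ∈ V1) → ¬(u ∈ V1 ↔ y ∈ V1) → σ x ≠ τ y := by
          intro x y ux uy e
          have hx := hσp x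
          have hy := hτp y
          rw [e] at hx
          grind
        by_cases ux : u ∈ V1 ↔ x ∈ V1 <;> by_cases uy : u ∈ V1 ↔ y ∈ V1
        · exact σ.injective (by simpa only [ρ, if_pos ux, if_pos uy] using hxy)
        · exact (hdisj x y ux uy (by simpa only [ρ, if_pos ux, if_neg uy] using hxy)).elim
        · exact (hdisj y x uy ux (by simpa only [ρ, if_neg ux, if_pos uy] using hxy.symm)).elim
        · exact τ.injective (by simpa only [ρ, if_neg ux, if_neg uy] using hxy)
      refine ⟨Equiv.ofBijective ρ (Finite.injective_iff_bijective.mp hρ), fun w => ?_⟩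
      simp only [Equiv.ofBijective_apply, ρ]
      have hw := hσp w
      have hw' := hτp w
      by_cases uw : u ∈ V1 ↔ w ∈ V1
      · rw [if_pos uw]
        refine ⟨mergeCrossing_congr hc hplain (hσ w).1, mergeCrossing_eq_iff.mpr (Or.inr ?_)⟩
        exact ⟨by grind, by grind, hc.diag_right (hσ w).1, hv.symm⟩
      · rw [if_neg uw]
        refine ⟨mergeCrossing_eq_iff.mpr (Or.inr ?_), mergeCrossing_congr hc hplain (hτ w).2⟩
        exact ⟨by grind, by grind, hu.symm, hc.diag_left (hτ w).2⟩

/-- Merging crossing colours still refines every family of relations inside the parts. -/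
theorem RefinesFamily.mergeCrossing {V K : Type} {V1 : Set V} {A : Set (Set (V × V))}
    (hA : ∀ E ∈ A, E ⊆ {p : V × V | p.1 ∈ V1 ↔ p.2 ∈ V1}) {c : V × V → K}
    (hcA : RefinesFamily c A) : RefinesFamily (mergeCrossing V1 c) A := by
  intro k E hE
  rw [or_iff_not_imp_right, Set.not_disjoint_iff]
  rintro ⟨⟨u, v⟩, rfl, hp⟩ ⟨u', v'⟩ hp'
  rcases mergeCrossing_eq_iff.mp hp' with ⟨-, -, h⟩ | ⟨-, h, -, -⟩
  · rcases hcA (c (u, v)) E hE with hsub | hdis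
    · exact hsub h
    · exact (Set.disjoint_left.mp hdis rfl hp).elim
  · exact (h (hA E hE hp)).elim

/-- In the normalised setting (all relations plain, both sides connected), every
colour class of a coarsest coherent configuration refining `A` is plain or crossing,
and each crossing class is determined by the diagonal colours of its endpoints. -/
theorem coarsest_plain_crossing_dichotomy {V K : Type} [Fintype V]
    (V1 : Set V) (A : Set (Set (V × V)))
    (hA : ∀ E ∈ A, E ⊆ {p : V × V | p.1 ∈ V1 ↔ p.2 ∈ V1})
    (h1 : GaifmanConnected A V1) (h2 : GaifmanConnected A V1ᶜ)
    (c : V × V → K) (hc : IsCoarsest c A) :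
    (∀ a : K, colourClass c a ⊆ {p : V × V | p.1 ∈ V1 ↔ p.2 ∈ V1} ∨
        colourClass c a ⊆ {p : V × V | ¬(p.1 ∈ V1 ↔ p.2 ∈ V1)}) ∧
    (∀ a : K, Attained c a →
      colourClass c a ⊆ {p : V × V | ¬(p.1 ∈ V1 ↔ p.2 ∈ V1)} →
      ∃ d1 d2 : K, Attained c d1 ∧ IsDiagonal c d1 ∧ Attained c d2 ∧ IsDiagonal c d2 ∧
        colourClass c a = {p : V × V | ¬(p.1 ∈ V1 ↔ p.2 ∈ V1) ∧
          c (p.1, p.1) = d1 ∧ c (p.2, p.2) = d2}) := by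
  obtain ⟨hcoh, hcA, hmin⟩ := hc
  have hplain : ∀ u v u' v', c (u, v) = c (u', v') →
      ((u ∈ V1 ↔ v ∈ V1) ↔ (u' ∈ V1 ↔ v' ∈ V1)) :=
    fun _ _ _ _ h => hcoh.plain_congr hA h1 h2 hcA h
  have hdiag : ∀ u : V, IsDiagonal c (c (u, u)) := by
    rintro u ⟨x, y⟩ hp
    obtain ⟨q, hd, -, -⟩ := hcoh
    exact (hd _ _ _ _ hp).mpr rfl
  refine ⟨fun a => ?_, ?_⟩
  · rw [or_iff_not_imp_left, Set.not_subset]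
    rintro ⟨p, rfl, hp⟩ p' hp' hpl
    exact hp ((hplain _ _ _ _ hp').mp hpl)
  · rintro _ ⟨⟨u, v⟩, rfl⟩ hcross
    refine ⟨c (u, u), c (v, v), ⟨_, rfl⟩, hdiag u, ⟨_, rfl⟩, hdiag v, Set.ext ?_⟩
    rintro ⟨x, y⟩
    constructor
    · intro h
      exact ⟨hcross h, hcoh.diag_left h, hcoh.diag_right h⟩
    · rintro ⟨hxy, hx, hy⟩
      have huv : ¬(u ∈ V1 ↔ v ∈ V1) :=
        hcross (show (u, v) ∈ colourClass c (c (u, v)) from rfl)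
      exact hmin _ (mergeCrossing V1 c) (hcoh.mergeCrossing hplain) (hcA.mergeCrossing hA) _ _
        (mergeCrossing_eq_iff.mpr (Or.inr ⟨hxy, huv, hx, hy⟩))
end

section
/- Let c be a coherent configuration on a finite set V, let a be an attained colour with class R, and let E be the binary relation on V that relates u and v if and only if u = v or u and v lie in a common strongly connected component of R (so E is an equivalence relation on V). Then for all attained colours b, b', the relations E ∘ class(b) ∘ E and E ∘ class(b') ∘ E are either equal or disjoint; in particular, they are equal if and only if they intersect non-trivially. -/
/-- Triangles over a pair can be transported to any pair of the same colour. -/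
theorem IsCoherent.exists_triangle {V K : Type} [Finite V] {c : V × V → K} (h : IsCoherent c)
    {u v u' v' : V} (huv : c (u, v) = c (u', v')) (w : V) :
    ∃ w', c (u, w) = c (u', w') ∧ c (w, v) = c (w', v') := by
  obtain ⟨q, -, -, hq⟩ := h
  have hcard := (hq _ (c (u, w)) (c (w, v)) u v huv).trans (hq _ _ _ u' v' rfl).symm
  have hpos : 0 < {x : V | c (u, x) = c (u, w) ∧ c (x, v) = c (w, v)}.ncard :=
    (Set.ncard_pos (Set.toFinite _)).2 ⟨w, rfl, rfl⟩
  rw [hcard] at hpos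
  obtain ⟨w', h₁, h₂⟩ := (Set.ncard_pos (Set.toFinite _)).1 hpos
  exact ⟨w', h₁.symm, h₂.symm⟩

theorem IsUnionOfClasses.relComp {V K : Type} [Finite V] {c : V × V → K} (h : IsCoherent c)
    {R S : Set (V × V)} (hR : IsUnionOfClasses c R) (hS : IsUnionOfClasses c S) :
    IsUnionOfClasses c (relComp R S) := by
  rintro ⟨u, v⟩ ⟨u', v'⟩ huv ⟨w, hw₁, hw₂⟩
  obtain ⟨w', h₁, h₂⟩ := h.exists_triangle huv w
  exact ⟨w', hR _ _ h₁ hw₁, hS _ _ h₂ hw₂⟩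

theorem isUnionOfClasses_colourClass {V K : Type} (c : V × V → K) (a : K) :
    IsUnionOfClasses c (colourClass c a) :=
  fun _ _ hp hpa => hp.symm.trans hpa

/-- The transitive closure of a union of colour classes is a union of colour classes. -/
theorem IsUnionOfClasses.transGen {V K : Type} [Finite V] {c : V × V → K} (h : IsCoherent c)
    {R : Set (V × V)} (hR : IsUnionOfClasses c R) {u v u' v' : V}
    (huv : c (u, v) = c (u', v')) (ht : Relation.TransGen (fun x y => (x, y) ∈ R) u v) :
    Relation.TransGen (fun x y => (x, y) ∈ R) u' v' := by
  induction ht generalizing v' with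
  | single hs => exact .single (hR _ _ huv hs)
  | @tail w _ _ hs ih =>
    obtain ⟨w', h₁, h₂⟩ := h.exists_triangle huv w
    exact .tail (ih h₁) (hR _ _ h₂ hs)

/-- Two vertices lie in a common strongly connected component if and only if each is reachable
from the other. -/
theorem exists_isSCC_mem_iff {V : Type} (R : Set (V × V)) (u v : V) :
    (∃ S, IsSCC R S ∧ u ∈ S ∧ v ∈ S) ↔
      Relation.TransGen (fun x y => (x, y) ∈ R) u v ∧
        Relation.TransGen (fun x y => (x, y) ∈ R) v u := by
  constructor
  · rintro ⟨S, hS, hu, hv⟩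
    exact ⟨hS.1 u hu v hv, hS.1 v hv u hu⟩
  · rintro ⟨huv, hvu⟩
    refine ⟨{w | Relation.TransGen (fun x y => (x, y) ∈ R) u w ∧
      Relation.TransGen (fun x y => (x, y) ∈ R) w u},
      ⟨fun x hx y hy => hx.2.trans hy.1, fun T hST hT => ?_⟩,
      ⟨huv.trans hvu, huv.trans hvu⟩, ⟨huv, hvu⟩⟩
    have hu : u ∈ T := hST ⟨huv.trans hvu, huv.trans hvu⟩
    exact Set.Subset.antisymm (fun w hw => ⟨hT u hu w hw, hT w hw u hu⟩) hST

/-- For an equivalence relation `E` that is a union of colour classes, saturations of colour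
classes that intersect are contained in each other. -/
theorem relComp_colourClass_subset {V K : Type} [Finite V] {c : V × V → K} (h : IsCoherent c)
    {E : Set (V × V)} (hE : IsUnionOfClasses c E) (hsymm : ∀ u v, (u, v) ∈ E → (v, u) ∈ E)
    (htrans : ∀ u v w, (u, v) ∈ E → (v, w) ∈ E → (u, w) ∈ E) {b b' : K}
    (hne : (relComp (relComp E (colourClass c b)) E ∩
      relComp (relComp E (colourClass c b')) E).Nonempty) :
    relComp (relComp E (colourClass c b)) E ⊆ relComp (relComp E (colourClass c b')) E := by
  obtain ⟨⟨x, y⟩, ⟨v, ⟨u, hxu, huv⟩, hvy⟩, ⟨v', ⟨u', hxu', huv'⟩, hvy'⟩⟩ := hne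
  have hmem : (u, v) ∈ relComp (relComp E (colourClass c b')) E :=
    ⟨v', ⟨u', htrans _ _ _ (hsymm _ _ hxu) hxu', huv'⟩, htrans _ _ _ hvy' (hsymm _ _ hvy)⟩
  have hunion : IsUnionOfClasses c (relComp (relComp E (colourClass c b')) E) :=
    .relComp h (.relComp h hE (isUnionOfClasses_colourClass c b')) hE
  rintro ⟨s, t⟩ ⟨n, ⟨m, hsm, hmn⟩, hnt⟩
  obtain ⟨n', ⟨m', hmm', hmn'⟩, hnn'⟩ := hunion (u, v) (m, n) (Eq.trans huv (Eq.symm hmn)) hmem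
  exact ⟨n', ⟨m', htrans _ _ _ hsm hmm', hmn'⟩, htrans _ _ _ hnn' hnt⟩

/-- Let `E` be the equivalence relation generated by the strongly connected
components of a colour class together with the identity. Then for attained colours
`b`, `b'`, the relations `E ∘ class b ∘ E` and `E ∘ class b' ∘ E` are equal or
disjoint; in particular they are equal iff they intersect non-trivially. -/
theorem scc_saturations_equal_or_disjoint {V K : Type} [Fintype V]
    (c : V × V → K) (h : IsCoherent c) (a : K) (ha : Attained c a)
    (E : Set (V × V))
    (hE : E = {p : V × V | p.1 = p.2 ∨
      ∃ S : Set V, IsSCC (colourClass c a) S ∧ p.1 ∈ S ∧ p.2 ∈ S})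
    (b b' : K) (hb : Attained c b) (hb' : Attained c b') :
    (relComp (relComp E (colourClass c b)) E = relComp (relComp E (colourClass c b')) E ∨
      Disjoint (relComp (relComp E (colourClass c b)) E)
        (relComp (relComp E (colourClass c b')) E)) ∧
    (relComp (relComp E (colourClass c b)) E = relComp (relComp E (colourClass c b')) E ↔
      (relComp (relComp E (colourClass c b)) E ∩
        relComp (relComp E (colourClass c b')) E).Nonempty) := by
  have hmem : ∀ u v, (u, v) ∈ E ↔ u = v ∨
      Relation.TransGen (fun x y => (x, y) ∈ colourClass c a) u v ∧
        Relation.TransGen (fun x y => (x, y) ∈ colourClass c a) v u := by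
    intro u v
    rw [← exists_isSCC_mem_iff, hE]
    rfl
  have hsymm : ∀ u v, (u, v) ∈ E → (v, u) ∈ E := by
    intro u v huv
    rw [hmem] at huv ⊢
    exact huv.imp Eq.symm And.symm
  have htrans : ∀ u v w, (u, v) ∈ E → (v, w) ∈ E → (u, w) ∈ E := by
    intro u v w huv hvw
    rw [hmem] at huv hvw ⊢
    rcases huv with rfl | huv
    · exact hvw
    rcases hvw with rfl | hvw
    · exact .inr huv
    · exact .inr ⟨huv.1.trans hvw.1, hvw.2.trans huv.2⟩
  have hunion : IsUnionOfClasses c E := by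
    rintro ⟨u, v⟩ ⟨u', v'⟩ huv huvE
    rw [hmem] at huvE ⊢
    have hclass := isUnionOfClasses_colourClass c a
    have hconv : c (v, u) = c (v', u') := h.elim fun _ hq => hq.2.1 _ _ _ _ huv
    refine huvE.imp (fun heq => ?_) fun ht => ⟨hclass.transGen h huv ht.1,
      hclass.transGen h hconv ht.2⟩
    exact h.elim fun _ hq => (hq.1 _ _ _ _ huv).1 heq
  have heq_of_nonempty : (relComp (relComp E (colourClass c b)) E ∩
      relComp (relComp E (colourClass c b')) E).Nonempty →
      relComp (relComp E (colourClass c b)) E = relComp (relComp E (colourClass c b')) E :=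
    fun hne => Set.Subset.antisymm (relComp_colourClass_subset h hunion hsymm htrans hne)
      (relComp_colourClass_subset h hunion hsymm htrans (Set.inter_comm _ _ ▸ hne))
  refine ⟨?_, fun heq => ?_, heq_of_nonempty⟩
  · rw [or_iff_not_imp_right, Set.not_disjoint_iff_nonempty_inter]
    exact heq_of_nonempty
  · obtain ⟨⟨u, v⟩, huv⟩ := hb
    rw [← heq, Set.inter_self]
    exact ⟨(u, v), v, ⟨u, (hmem u u).2 (.inl rfl), huv⟩, (hmem v v).2 (.inl rfl)⟩
end

section
/- Let V = V1 ⊎ V2 be a finite set partitioned into two parts, let A be a family of binary relations on V with every relation contained in V1² ∪ V2², and assume the Gaifman graph of A restricted to V1 and the Gaifman graph of A restricted to V2 are both connected. Let c be a coarsest coherent configuration refining A and let ω be a set of attained colours of c whose classes are contained in the crossing pairs (V1 × V2) ∪ (V2 × V1). Let P := ⋃_{a ∈ ω} class(a), and let A^ω be the structure with universe V ⊎ P (each pair in P added as a fresh vertex) whose relations are: all relations of A (on V), the relation E_left := {(u, (u,v)) : (u,v) ∈ P}, the relation E_right := {(v, (u,v)) : (u,v) ∈ P}, and for each a ∈ ω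 the diagonal relation D_a := {((u,v),(u,v)) : (u,v) ∈ class(a)}. Let c^ω be a coarsest coherent configuration refining A^ω. Then c^ω restricted to V × V induces the same partition of V × V as c: for all u, v, u', v' ∈ V, c(u,v) = c(u',v') if and only if c^ω(u,v) = c^ω(u',v'). -/
/-- A family of colour-respecting injections witnesses condition (iii) of coherence. -/
theorem IsCoherent.of_injections {V K : Type} [Finite V] {c : V × V → K}
    (hd : ∀ u v u' v' : V, c (u, v) = c (u', v') → (u = v → u' = v'))
    (ht : ∀ u v u' v' : V, c (u, v) = c (u', v') → c (v, u) = c (v', u'))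
    (hφ : ∀ u v u' v' : V, c (u, v) = c (u', v') → ∃ φ : V → V, Function.Injective φ ∧
      ∀ w, c (u, w) = c (u', φ w) ∧ c (w, v) = c (φ w, v')) :
    IsCoherent c := by
  classical
  have hle : ∀ (b d : K) (u v u' v' : V), c (u, v) = c (u', v') →
      {w : V | c (u, w) = b ∧ c (w, v) = d}.ncard ≤
        {w : V | c (u', w) = b ∧ c (w, v') = d}.ncard := by
    intro b d u v u' v' h
    obtain ⟨φ, hinj, hw⟩ := hφ u v u' v' h
    refine Set.ncard_le_ncard_of_injOn φ ?_ hinj.injOn (Set.toFinite _)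
    rintro w ⟨h1, h2⟩
    exact ⟨(hw w).1 ▸ h1, (hw w).2 ▸ h2⟩
  refine ⟨fun k => if h : ∃ p : V × V, c p = k.1 then
      {w : V | c (h.choose.1, w) = k.2.1 ∧ c (w, h.choose.2) = k.2.2}.ncard else 0,
    fun u v u' v' h => ⟨hd _ _ _ _ h, hd _ _ _ _ h.symm⟩, ht, ?_⟩
  intro a b d u v h
  have hex : ∃ p : V × V, c p = a := ⟨_, h⟩
  have hch : c (u, v) = c (hex.choose.1, hex.choose.2) := h.trans hex.choose_spec.symm
  simp only [dif_pos hex]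
  exact le_antisymm (hle _ _ _ _ _ _ hch) (hle _ _ _ _ _ _ hch.symm)

/-- Two maps on a finite type with equinumerous fibres differ by an injection of the domain. -/
theorem exists_injective_of_ncard_fibre_eq {V L : Type} [Finite V] (f g : V → L)
    (h : ∀ k, {w | f w = k}.ncard = {w | g w = k}.ncard) :
    ∃ φ : V → V, Function.Injective φ ∧ ∀ w, f w = g (φ w) := by
  have he : ∀ k, Nonempty ({w // f w = k} ≃ {w // g w = k}) := fun k =>
    Finite.card_eq.1 (h k)
  let e := fun k => (he k).some
  refine ⟨(Equiv.sigmaFiberEquiv f).symm.trans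
    ((Equiv.sigmaCongrRight e).trans (Equiv.sigmaFiberEquiv g)), Equiv.injective _, fun w => ?_⟩
  exact (e (f w) ⟨w, rfl⟩).2.symm

namespace IsCoherent

variable {V K : Type} {c : V × V → K}

theorem eq_iff (hc : IsCoherent c) {u v u' v' : V} (h : c (u, v) = c (u', v')) :
    u = v ↔ u' = v' := by
  obtain ⟨q, h1, -, -⟩ := hc
  exact h1 _ _ _ _ h

theorem swap (hc : IsCoherent c) {u v u' v' : V} (h : c (u, v) = c (u', v')) :
    c (v, u) = c (v', u') := by
  obtain ⟨q, -, h2, -⟩ := hc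
  exact h2 _ _ _ _ h

theorem exists_injection [Finite V] (hc : IsCoherent c) {u v u' v' : V}
    (h : c (u, v) = c (u', v')) : ∃ φ : V → V, Function.Injective φ ∧
      ∀ w, c (u, w) = c (u', φ w) ∧ c (w, v) = c (φ w, v') := by
  obtain ⟨q, -, -, h3⟩ := hc
  obtain ⟨φ, hinj, hw⟩ := exists_injective_of_ncard_fibre_eq
    (fun w => (c (u, w), c (w, v))) (fun w => (c (u', w), c (w, v'))) (by
      rintro ⟨b, d⟩
      simp only [Prod.mk.injEq]
      rw [h3 _ b d u v h, h3 _ b d u' v' rfl])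
  exact ⟨φ, hinj, fun w => Prod.ext_iff.1 (hw w)⟩

theorem diag_left_s17 [Finite V] (hc : IsCoherent c) {u v u' v' : V}
    (h : c (u, v) = c (u', v')) : c (u, u) = c (u', u') := by
  obtain ⟨φ, -, hw⟩ := hc.exists_injection h
  have h1 := (hw u).1
  rwa [← (hc.eq_iff h1).1 rfl] at h1

theorem diag_right_s17 [Finite V] (hc : IsCoherent c) {u v u' v' : V}
    (h : c (u, v) = c (u', v')) : c (v, v) = c (v', v') :=
  hc.diag_left_s17 (hc.swap h)

end IsCoherent

theorem RefinesFamily.mem {V K : Type} {c : V × V → K} {A : Set (Set (V × V))}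
    (h : RefinesFamily c A) {E : Set (V × V)} (hE : E ∈ A) {p p' : V × V}
    (hp : c p = c p') (hm : p ∈ E) : p' ∈ E := by
  rcases h (c p) E hE with h | h
  · exact h hp.symm
  · exact absurd hm (Set.disjoint_left.1 h rfl)

theorem RefinesFamily.of_mem {V K : Type} {c : V × V → K} {A : Set (Set (V × V))}
    (h : ∀ E ∈ A, ∀ p p', c p = c p' → p ∈ E → p' ∈ E) : RefinesFamily c A := by
  intro a E hE
  by_cases hx : ∃ p, c p = a ∧ p ∈ E
  · obtain ⟨p, rfl, hp⟩ := hx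
    exact Or.inl fun p' hp' => h E hE p p' hp'.symm hp
  · exact Or.inr (Set.disjoint_left.2 fun p hp hpE => hx ⟨p, hp, hpE⟩)

/-- A coherent configuration refining `A` distinguishes reachability in the Gaifman graph. -/
theorem reflTransGen_of_colour_eq {V K : Type} [Finite V] {c : V × V → K}
    {A : Set (Set (V × V))} (hc : IsCoherent c) (hA : RefinesFamily c A) {u v : V}
    (h : Relation.ReflTransGen (fun x y => ∃ E ∈ A, (x, y) ∈ E ∨ (y, x) ∈ E) u v) :
    ∀ {u' v' : V}, c (u, v) = c (u', v') →
      Relation.ReflTransGen (fun x y => ∃ E ∈ A, (x, y) ∈ E ∨ (y, x) ∈ E) u' v' := by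
  induction h with
  | refl =>
    intro u' v' h
    rw [(hc.eq_iff h).1 rfl]
  | tail _ hxv ih =>
    intro u' v' h
    obtain ⟨φ, -, hw⟩ := hc.exists_injection h
    obtain ⟨E, hE, hm⟩ := hxv
    exact (ih (hw _).1).tail ⟨E, hE, hm.imp (hA.mem hE (hw _).2)
      (hA.mem hE (hc.swap (hw _).2))⟩

/-- With both parts connected, being a crossing pair depends on the colour only. -/
theorem side_of_colour_eq {V K : Type} [Finite V] {V1 : Set V} {A : Set (Set (V × V))}
    (hA : ∀ E ∈ A, E ⊆ {p : V × V | p.1 ∈ V1 ↔ p.2 ∈ V1})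
    (h1 : GaifmanConnected A V1) (h2 : GaifmanConnected A V1ᶜ)
    {c : V × V → K} (hc : IsCoherent c) (hcA : RefinesFamily c A) {u v u' v' : V}
    (h : c (u, v) = c (u', v')) (hs : u ∈ V1 ↔ v ∈ V1) : u' ∈ V1 ↔ v' ∈ V1 := by
  have hr : Relation.ReflTransGen (fun x y => ∃ E ∈ A, (x, y) ∈ E ∨ (y, x) ∈ E) u v := by
    by_cases hu : u ∈ V1
    · exact Relation.ReflTransGen.mono (fun _ _ h => h.2.2) _ _ (h1.2 u hu v (hs.1 hu))
    · exact Relation.ReflTransGen.mono (fun _ _ h => h.2.2) _ _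
        (h2.2 u hu v (fun hv => hu (hs.2 hv)))
  have hr' := reflTransGen_of_colour_eq hc hcA hr h
  clear h
  induction hr' with
  | refl => rfl
  | tail _ hxv ih =>
    obtain ⟨E, hE, hm⟩ := hxv
    rcases hm with hm | hm
    · exact ih.trans (hA E hE hm)
    · exact ih.trans (hA E hE hm).symm

section TwoParts

variable {V K : Type} {V1 : Set V} {c : V × V → K}

/-- The map acting as `φ` on the part of `a` and as `ψ` on the other part. -/
noncomputable def glue (V1 : Set V) (a : V) (φ ψ : V → V) (w : V) : V :=
  open Classical in if (a ∈ V1 ↔ w ∈ V1) then φ w else ψ w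

theorem glue_of_same {a w : V} (φ ψ : V → V) (h : a ∈ V1 ↔ w ∈ V1) :
    glue V1 a φ ψ w = φ w := if_pos h

theorem glue_of_cross {a w : V} (φ ψ : V → V) (h : ¬(a ∈ V1 ↔ w ∈ V1)) :
    glue V1 a φ ψ w = ψ w := if_neg h

theorem glue_side {a a' : V} {φ ψ : V → V}
    (hφs : ∀ w, (a ∈ V1 ↔ w ∈ V1) ↔ (a' ∈ V1 ↔ φ w ∈ V1))
    (hψs : ∀ w, (a ∈ V1 ↔ w ∈ V1) ↔ (a' ∈ V1 ↔ ψ w ∈ V1)) (w : V) :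
    (a ∈ V1 ↔ w ∈ V1) ↔ (a' ∈ V1 ↔ glue V1 a φ ψ w ∈ V1) := by
  by_cases h : (a ∈ V1 ↔ w ∈ V1)
  · rw [glue_of_same φ ψ h]; exact hφs w
  · rw [glue_of_cross φ ψ h]; exact hψs w

theorem glue_injective {a a' : V} {φ ψ : V → V}
    (hφ : Function.Injective φ) (hψ : Function.Injective ψ)
    (hφs : ∀ w, (a ∈ V1 ↔ w ∈ V1) ↔ (a' ∈ V1 ↔ φ w ∈ V1))
    (hψs : ∀ w, (a ∈ V1 ↔ w ∈ V1) ↔ (a' ∈ V1 ↔ ψ w ∈ V1)) :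
    Function.Injective (glue V1 a φ ψ) := by
  intro w x hwx
  have hw := glue_side hφs hψs w
  have hx := glue_side hφs hψs x
  rw [hwx] at hw
  by_cases h : (a ∈ V1 ↔ w ∈ V1)
  · rw [glue_of_same φ ψ h, glue_of_same φ ψ (hx.2 (hw.1 h))] at hwx
    exact hφ hwx
  · rw [glue_of_cross φ ψ h, glue_of_cross φ ψ (fun h' => h (hw.2 (hx.1 h')))] at hwx
    exact hψ hwx

/-- In a coarsest configuration of two connected parts, the colour of a crossing pair is
determined by the colours of its ends. -/
theorem colour_eq_of_crossing [Finite V] {A : Set (Set (V × V))}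
    (hA : ∀ E ∈ A, E ⊆ {p : V × V | p.1 ∈ V1 ↔ p.2 ∈ V1})
    (hc : IsCoarsest c A)
    (hs : ∀ {u v u' v' : V}, c (u, v) = c (u', v') →
      ((u ∈ V1 ↔ v ∈ V1) ↔ (u' ∈ V1 ↔ v' ∈ V1)))
    {u v u' v' : V} (h : ¬(u ∈ V1 ↔ v ∈ V1)) (h' : ¬(u' ∈ V1 ↔ v' ∈ V1))
    (hu : c (u, u) = c (u', u')) (hv : c (v, v) = c (v', v')) :
    c (u, v) = c (u', v') := by
  classical
  obtain ⟨hcc, hcA, hmin⟩ := hc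
  let d : V × V → K × K × Option K := fun p => (c (p.1, p.1), c (p.2, p.2),
    if (p.1 ∈ V1 ↔ p.2 ∈ V1) then some (c p) else none)
  have hd : ∀ u v u' v' : V, d (u, v) = d (u', v') ↔ c (u, u) = c (u', u') ∧
      c (v, v) = c (v', v') ∧ ((u ∈ V1 ↔ v ∈ V1) ↔ (u' ∈ V1 ↔ v' ∈ V1)) ∧
      ((u ∈ V1 ↔ v ∈ V1) → c (u, v) = c (u', v')) := by
    intro u v u' v'
    simp only [d, Prod.mk.injEq]
    by_cases h1 : (u ∈ V1 ↔ v ∈ V1) <;> by_cases h2 : (u' ∈ V1 ↔ v' ∈ V1) <;>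
      simp [h1, h2]
  have hdc : ∀ {u v u' v' : V}, c (u, v) = c (u', v') → d (u, v) = d (u', v') :=
    fun h => (hd _ _ _ _).2 ⟨hcc.diag_left_s17 h, hcc.diag_right_s17 h, hs h, fun _ => h⟩
  have hdcoh : IsCoherent d := by
    refine IsCoherent.of_injections ?_ ?_ ?_
    · rintro u _ u' v' h rfl
      exact (hcc.eq_iff (((hd _ _ _ _).1 h).2.2.2 Iff.rfl)).1 rfl
    · intro u v u' v' h
      obtain ⟨h1, h2, h3, h4⟩ := (hd _ _ _ _).1 h
      refine (hd _ _ _ _).2 ⟨h2, h1, ?_, fun h5 => hcc.swap (h4 h5.symm)⟩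
      rw [iff_comm (a := v ∈ V1), iff_comm (a := v' ∈ V1)]
      exact h3
    · intro u v u' v' h
      obtain ⟨h1, h2, h3, h4⟩ := (hd _ _ _ _).1 h
      by_cases h5 : (u ∈ V1 ↔ v ∈ V1)
      · obtain ⟨φ, hφ, hw⟩ := hcc.exists_injection (h4 h5)
        exact ⟨φ, hφ, fun w => ⟨hdc (hw w).1, hdc (hw w).2⟩⟩
      · have h6 : ¬(u' ∈ V1 ↔ v' ∈ V1) := fun h6 => h5 (h3.2 h6)
        obtain ⟨φ, hφ, hφw⟩ := hcc.exists_injection h1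
        obtain ⟨ψ, hψ, hψw⟩ := hcc.exists_injection h2
        have hφs : ∀ w, (u ∈ V1 ↔ w ∈ V1) ↔ (u' ∈ V1 ↔ φ w ∈ V1) := fun w => hs (hφw w).1
        have hψs : ∀ w, (u ∈ V1 ↔ w ∈ V1) ↔ (u' ∈ V1 ↔ ψ w ∈ V1) := fun w => by
          have := hs (hψw w).1
          grind
        refine ⟨glue V1 u φ ψ, glue_injective hφ hψ hφs hψs, fun w => ?_⟩
        have hg := glue_side hφs hψs w
        by_cases h7 : (u ∈ V1 ↔ w ∈ V1)
        · rw [glue_of_same φ ψ h7] at hg ⊢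
          refine ⟨hdc (hφw w).1, (hd _ _ _ _).2
            ⟨hcc.diag_right_s17 (hφw w).1, h2, by grind, fun h8 => absurd h8 (by grind)⟩⟩
        · rw [glue_of_cross φ ψ h7] at hg ⊢
          refine ⟨(hd _ _ _ _).2 ⟨h1, hcc.diag_right_s17 (hψw w).1, by grind,
            fun h8 => absurd h8 (by grind)⟩, hdc (hψw w).2⟩
  have hdA : RefinesFamily d A := by
    refine RefinesFamily.of_mem fun E hE p p' hp hm => hcA.mem hE ?_ hm
    exact ((hd _ _ _ _).1 hp).2.2.2 (hA E hE hm)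
  exact hmin _ d hdcoh hdA _ _ ((hd _ _ _ _).2
    ⟨hu, hv, iff_of_false h h', fun h'' => absurd h'' h⟩)

/-- A single injection of `V` that respects the colours to four given points. -/
theorem exists_injection_four [Finite V] (hcc : IsCoherent c)
    (hs : ∀ {u v u' v' : V}, c (u, v) = c (u', v') →
      ((u ∈ V1 ↔ v ∈ V1) ↔ (u' ∈ V1 ↔ v' ∈ V1)))
    (hx : ∀ {u v u' v' : V}, ¬(u ∈ V1 ↔ v ∈ V1) → ¬(u' ∈ V1 ↔ v' ∈ V1) →
      c (u, u) = c (u', u') → c (v, v) = c (v', v') → c (u, v) = c (u', v'))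
    {a b s t a' b' s' t' : V}
    (has : c (a, s) = c (a', s')) (hbt : c (b, t) = c (b', t'))
    (hab : c (a, b) = c (a', b')) (hst : c (s, t) = c (s', t'))
    (hab' : a = b ∨ ¬(a ∈ V1 ↔ b ∈ V1))
    (hst' : s = t ∨ (a ∈ V1 ↔ s ∈ V1) ∧ ¬(a ∈ V1 ↔ t ∈ V1)) :
    ∃ φ : V → V, Function.Injective φ ∧
      (∀ w x, ¬(w ∈ V1 ↔ x ∈ V1) → c (w, x) = c (φ w, φ x)) ∧
      ∀ w, c (w, w) = c (φ w, φ w) ∧ c (a, w) = c (a', φ w) ∧ c (b, w) = c (b', φ w) ∧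
        c (w, s) = c (φ w, s') ∧ c (w, t) = c (φ w, t') := by
  obtain ⟨φ, hφ, hφw⟩ := hcc.exists_injection has
  obtain ⟨ψ, hψ, hψw⟩ := hcc.exists_injection hbt
  have hφs : ∀ w, (a ∈ V1 ↔ w ∈ V1) ↔ (a' ∈ V1 ↔ φ w ∈ V1) := fun w => hs (hφw w).1
  have hψs : ∀ w, (a ∈ V1 ↔ w ∈ V1) ↔ (a' ∈ V1 ↔ ψ w ∈ V1) := fun w => by
    have := hs (hψw w).1
    have := hs hab
    grind
  have hg := glue_side hφs hψs
  have hdiag : ∀ w, c (w, w) = c (glue V1 a φ ψ w, glue V1 a φ ψ w) := by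
    intro w
    by_cases h : (a ∈ V1 ↔ w ∈ V1)
    · rw [glue_of_same φ ψ h]; exact hcc.diag_right_s17 (hφw w).1
    · rw [glue_of_cross φ ψ h]; exact hcc.diag_right_s17 (hψw w).1
  have hsas := hs has
  have hsab := hs hab
  have hsst := hs hst
  -- crossing pairs are handled by `hx`, so only points on the part of `w` matter
  have key : ∀ w p p' : V, c (p, p) = c (p', p') →
      ((a ∈ V1 ↔ p ∈ V1) ↔ (a' ∈ V1 ↔ p' ∈ V1)) →
      ((a ∈ V1 ↔ w ∈ V1) → (a ∈ V1 ↔ p ∈ V1) → c (p, w) = c (p', φ w)) →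
      (¬(a ∈ V1 ↔ w ∈ V1) → ¬(a ∈ V1 ↔ p ∈ V1) → c (p, w) = c (p', ψ w)) →
      c (p, w) = c (p', glue V1 a φ ψ w) := by
    intro w p p' hp hpp h1 h2
    by_cases hpw : (p ∈ V1 ↔ w ∈ V1)
    · by_cases h : (a ∈ V1 ↔ w ∈ V1)
      · rw [glue_of_same φ ψ h]; exact h1 h (by grind)
      · rw [glue_of_cross φ ψ h]; exact h2 h (by grind)
    · have := hg w
      exact hx hpw (by grind) hp (hdiag w)
  refine ⟨glue V1 a φ ψ, glue_injective hφ hψ hφs hψs, fun w x hwx => ?_, fun w => ⟨hdiag w, ?_⟩⟩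
  · have h1 := hg w
    have h2 := hg x
    exact hx hwx (by grind) (hdiag w) (hdiag x)
  · refine ⟨?_, ?_, hcc.swap ?_, hcc.swap ?_⟩
    · exact key w a a' (hcc.diag_left_s17 hab) (by grind) (fun _ _ => (hφw w).1)
        (fun _ h => absurd Iff.rfl h)
    · refine key w b b' (hcc.diag_left_s17 hbt) hsab (fun _ h => ?_) (fun _ _ => (hψw w).1)
      obtain rfl : a = b := hab'.resolve_right (not_not.2 h)
      obtain rfl : a' = b' := (hcc.eq_iff hab).1 rfl
      exact (hφw w).1
    · refine key w s s' (hcc.diag_left_s17 hst) hsas (fun _ _ => hcc.swap (hφw w).2) (fun _ h => ?_)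
      obtain rfl : s = t := hst'.resolve_right (fun h' => h h'.1)
      obtain rfl : s' = t' := (hcc.eq_iff hst).1 rfl
      exact hcc.swap (hψw w).2
    · refine key w t t' (hcc.diag_right_s17 hst) (by grind) (fun _ h => ?_)
        (fun _ _ => hcc.swap (hψw w).2)
      obtain rfl : s = t := hst'.resolve_right (fun h' => h'.2 h)
      obtain rfl : s' = t' := (hcc.eq_iff hst).1 rfl
      exact hcc.swap (hφw w).2

end TwoParts

/-- The pair of elements of `V` underlying a vertex of `V ⊎ P`. -/
def vertexEnds {V : Type} {P : Set (V × V)} : V ⊕ ↥P → V × V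
  | Sum.inl u => (u, u)
  | Sum.inr p => p

/-- The colouring of `V ⊎ P` recording the colours among the ends of both vertices. -/
def endsColouring {V K : Type} (P : Set (V × V)) (c : V × V → K) :
    (V ⊕ ↥P) × (V ⊕ ↥P) → (K × K) × (K × K) × K × K := fun z =>
  ((c (vertexEnds z.1), c (vertexEnds z.2)),
   (c ((vertexEnds z.1).1, (vertexEnds z.2).1), c ((vertexEnds z.1).1, (vertexEnds z.2).2)),
   c ((vertexEnds z.1).2, (vertexEnds z.2).1), c ((vertexEnds z.1).2, (vertexEnds z.2).2))

section EndsColouring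

variable {V K : Type} {P : Set (V × V)} {c : V × V → K}

theorem endsColouring_eq_iff {z w z' w' : V ⊕ ↥P} :
    endsColouring P c (z, w) = endsColouring P c (z', w') ↔
      (c (vertexEnds z) = c (vertexEnds z') ∧ c (vertexEnds w) = c (vertexEnds w')) ∧
      (c ((vertexEnds z).1, (vertexEnds w).1) = c ((vertexEnds z').1, (vertexEnds w').1) ∧
       c ((vertexEnds z).1, (vertexEnds w).2) = c ((vertexEnds z').1, (vertexEnds w').2)) ∧
      c ((vertexEnds z).2, (vertexEnds w).1) = c ((vertexEnds z').2, (vertexEnds w').1) ∧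
      c ((vertexEnds z).2, (vertexEnds w).2) = c ((vertexEnds z').2, (vertexEnds w').2) := by
  simp only [endsColouring, Prod.mk.injEq]

theorem vertexEnds_injective (hP : ∀ p ∈ P, p.1 ≠ p.2) :
    Function.Injective (vertexEnds : V ⊕ ↥P → V × V) := by
  rintro (u | p) (v | q) h
  · exact congrArg Sum.inl (congrArg Prod.fst h)
  · exact absurd ((congrArg Prod.fst h).symm.trans (congrArg Prod.snd h)) (hP q q.2)
  · exact absurd ((congrArg Prod.fst h).trans (congrArg Prod.snd h).symm) (hP p p.2)
  · exact congrArg Sum.inr (Subtype.ext h)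

/-- Pair-vertices are exactly the vertices with distinct ends. -/
theorem exists_inl_iff (hP : ∀ p ∈ P, p.1 ≠ p.2) (z : V ⊕ ↥P) :
    (∃ u, z = Sum.inl u) ↔ (vertexEnds z).1 = (vertexEnds z).2 := by
  rcases z with u | p
  · simp [vertexEnds]
  · simpa [vertexEnds] using hP p p.2

/-- For crossing `P` closed under colour, `endsColouring` is coherent. -/
theorem endsColouring_isCoherent [Finite V] {V1 : Set V} (hcc : IsCoherent c)
    (hs : ∀ {u v u' v' : V}, c (u, v) = c (u', v') →
      ((u ∈ V1 ↔ v ∈ V1) ↔ (u' ∈ V1 ↔ v' ∈ V1)))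
    (hx : ∀ {u v u' v' : V}, ¬(u ∈ V1 ↔ v ∈ V1) → ¬(u' ∈ V1 ↔ v' ∈ V1) →
      c (u, u) = c (u', u') → c (v, v) = c (v', v') → c (u, v) = c (u', v'))
    (hPc : ∀ p ∈ P, ¬(p.1 ∈ V1 ↔ p.2 ∈ V1)) (hPu : IsUnionOfClasses c P) :
    IsCoherent (endsColouring P c) := by
  have hPne : ∀ p ∈ P, p.1 ≠ p.2 := fun p hp h => hPc p hp (by rw [h])
  have hends : ∀ z : V ⊕ ↥P, (vertexEnds z).1 = (vertexEnds z).2 ∨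
      ¬((vertexEnds z).1 ∈ V1 ↔ (vertexEnds z).2 ∈ V1) := by
    rintro (u | p)
    · exact Or.inl rfl
    · exact Or.inr (hPc p p.2)
  refine IsCoherent.of_injections ?_ ?_ ?_
  · rintro z _ z' w' h rfl
    obtain ⟨-, ⟨h1, -⟩, -, h2⟩ := endsColouring_eq_iff.1 h
    exact vertexEnds_injective hPne
      (Prod.ext ((hcc.eq_iff h1).1 rfl) ((hcc.eq_iff h2).1 rfl))
  · intro z w z' w' h
    obtain ⟨⟨h1, h2⟩, ⟨h3, h4⟩, h5, h6⟩ := endsColouring_eq_iff.1 h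
    exact endsColouring_eq_iff.2
      ⟨⟨h2, h1⟩, ⟨hcc.swap h3, hcc.swap h5⟩, hcc.swap h4, hcc.swap h6⟩
  · intro z w z' w' h
    obtain ⟨⟨h1, h2⟩, ⟨h3, h4⟩, h5, h6⟩ := endsColouring_eq_iff.1 h
    obtain ⟨φ, hφ, hcross, hfour⟩ : ∃ φ : V → V, Function.Injective φ ∧
        (∀ x y, ¬(x ∈ V1 ↔ y ∈ V1) → c (x, y) = c (φ x, φ y)) ∧
        ∀ x, c (x, x) = c (φ x, φ x) ∧
          c ((vertexEnds z).1, x) = c ((vertexEnds z').1, φ x) ∧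
          c ((vertexEnds z).2, x) = c ((vertexEnds z').2, φ x) ∧
          c (x, (vertexEnds w).1) = c (φ x, (vertexEnds w').1) ∧
          c (x, (vertexEnds w).2) = c (φ x, (vertexEnds w').2) := by
      have hw := hends w
      by_cases hzw : ((vertexEnds z).1 ∈ V1 ↔ (vertexEnds w).1 ∈ V1)
      · exact exists_injection_four hcc hs hx h3 h6 h1 h2 (hends z)
          (hw.imp_right fun h => ⟨hzw, by grind⟩)
      · obtain ⟨φ, hφ, hcross, hfour⟩ := exists_injection_four hcc hs hx h4 h5 h1
          (hcc.swap h2) (hends z) (hw.imp Eq.symm fun h => ⟨by grind, hzw⟩)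
        exact ⟨φ, hφ, hcross, fun x => ⟨(hfour x).1, (hfour x).2.1, (hfour x).2.2.1,
          (hfour x).2.2.2.2, (hfour x).2.2.2.1⟩⟩
    have hPφ : ∀ p : ↥P, (φ (p : V × V).1, φ (p : V × V).2) ∈ P := fun p =>
      hPu p _ (hcross _ _ (hPc p p.2)) p.2
    let Φ : V ⊕ ↥P → V ⊕ ↥P := Sum.map φ (fun p => ⟨_, hPφ p⟩)
    have hΦ : ∀ x, vertexEnds (Φ x) = Prod.map φ φ (vertexEnds x) := by
      rintro (u | p) <;> rfl
    have hcol : ∀ x : V ⊕ ↥P, c (vertexEnds x) = c (vertexEnds (Φ x)) := by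
      rintro (u | p)
      · exact (hfour u).1
      · exact hcross _ _ (hPc p p.2)
    refine ⟨Φ, fun x y hxy => vertexEnds_injective hPne
      (hφ.prodMap hφ ?_), fun x => ⟨?_, ?_⟩⟩
    · rw [← hΦ, ← hΦ, hxy]
    · refine endsColouring_eq_iff.2 ⟨⟨h1, hcol x⟩, ?_⟩
      rw [hΦ]
      exact ⟨⟨(hfour _).2.1, (hfour _).2.1⟩, (hfour _).2.2.1, (hfour _).2.2.1⟩
    · refine endsColouring_eq_iff.2 ⟨⟨hcol x, h2⟩, ?_⟩
      rw [hΦ]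
      exact ⟨⟨(hfour _).2.2.2.1, (hfour _).2.2.2.2⟩, (hfour _).2.2.2.1, (hfour _).2.2.2.2⟩

end EndsColouring

/-- A coherent configuration restricts to a coherent configuration on a part whose loops
do not share a colour with the loops outside. -/
theorem IsCoherent.restrict_inl {V W K : Type} [Finite V] [Finite W]
    {c : (V ⊕ W) × (V ⊕ W) → K} (hc : IsCoherent c)
    (h : ∀ (u : V) (w : W), c (Sum.inl u, Sum.inl u) ≠ c (Sum.inr w, Sum.inr w)) :
    IsCoherent (fun p : V × V => c (Sum.inl p.1, Sum.inl p.2)) := by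
  refine IsCoherent.of_injections ?_ (fun u v u' v' h => hc.swap h) ?_
  · rintro u _ u' v' h rfl
    exact Sum.inl_injective ((hc.eq_iff h).1 rfl)
  · intro u v u' v' huv
    obtain ⟨φ, hφ, hw⟩ := hc.exists_injection huv
    have hex : ∀ x : V, ∃ y : V, φ (Sum.inl x) = Sum.inl y := by
      intro x
      have hx := hc.diag_right_s17 (hw (Sum.inl x)).1
      rcases hy : φ (Sum.inl x) with y | y
      · exact ⟨y, rfl⟩
      · rw [hy] at hx
        exact absurd hx (h x y)
    choose ψ hψ using hex
    refine ⟨ψ, fun x y hxy => Sum.inl_injective (hφ ?_), fun x => ?_⟩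
    · rw [hψ, hψ, hxy]
    · simpa only [hψ] using hw (Sum.inl x)

/-- Adding pair-vertices for crossing colour classes of a coarsest coherent
configuration in the normalised setting does not change the induced partition of
`V × V`. -/
theorem addPair_crossing_preserves_partition {V K K' : Type} [Fintype V]
    (V1 : Set V) (A : Set (Set (V × V)))
    (hA : ∀ E ∈ A, E ⊆ {p : V × V | p.1 ∈ V1 ↔ p.2 ∈ V1})
    (h1 : GaifmanConnected A V1) (h2 : GaifmanConnected A V1ᶜ)
    (c : V × V → K) (hc : IsCoarsest c A)
    (ω : Set K)
    (hω : ∀ a ∈ ω, Attained c a ∧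
      colourClass c a ⊆ {p : V × V | ¬(p.1 ∈ V1 ↔ p.2 ∈ V1)})
    (P : Set (V × V)) (hP : P = {p : V × V | c p ∈ ω})
    (Eleft Eright : Set ((V ⊕ ↥P) × (V ⊕ ↥P)))
    (hEleft : Eleft = {q | ∃ p : ↥P, q = (Sum.inl (p : V × V).1, Sum.inr p)})
    (hEright : Eright = {q | ∃ p : ↥P, q = (Sum.inl (p : V × V).2, Sum.inr p)})
    (lift : Set (V × V) → Set ((V ⊕ ↥P) × (V ⊕ ↥P)))
    (hlift : ∀ E : Set (V × V),
      lift E = {q | ∃ u v : V, q = (Sum.inl u, Sum.inl v) ∧ (u, v) ∈ E})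
    (Dfam : Set (Set ((V ⊕ ↥P) × (V ⊕ ↥P))))
    (hDfam : Dfam = {D | ∃ a ∈ ω,
      D = {q | ∃ p : ↥P, q = (Sum.inr p, Sum.inr p) ∧ c (p : V × V) = a}})
    (c' : (V ⊕ ↥P) × (V ⊕ ↥P) → K')
    (hc' : IsCoarsest c' (lift '' A ∪ {Eleft, Eright} ∪ Dfam)) :
    ∀ u v u' v' : V,
      c (u, v) = c (u', v') ↔
        c' (Sum.inl u, Sum.inl v) = c' (Sum.inl u', Sum.inl v') := by
  obtain ⟨hcc, hcA, hmin⟩ := id hc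
  obtain ⟨hcc', hcA', hmin'⟩ := hc'
  have hs : ∀ {u v u' v' : V}, c (u, v) = c (u', v') →
      ((u ∈ V1 ↔ v ∈ V1) ↔ (u' ∈ V1 ↔ v' ∈ V1)) := fun h =>
    ⟨side_of_colour_eq hA h1 h2 hcc hcA h, side_of_colour_eq hA h1 h2 hcc hcA h.symm⟩
  have hx : ∀ {u v u' v' : V}, ¬(u ∈ V1 ↔ v ∈ V1) → ¬(u' ∈ V1 ↔ v' ∈ V1) →
      c (u, u) = c (u', u') → c (v, v) = c (v', v') → c (u, v) = c (u', v') :=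
    colour_eq_of_crossing hA hc hs
  have hPω : ∀ p, p ∈ P ↔ c p ∈ ω := fun p => by rw [hP]; rfl
  have hPc : ∀ p ∈ P, ¬(p.1 ∈ V1 ↔ p.2 ∈ V1) := fun p hp =>
    (hω _ ((hPω p).1 hp)).2 rfl
  have hPne : ∀ p ∈ P, p.1 ≠ p.2 := fun p hp h => hPc p hp (by rw [h])
  have hPu : IsUnionOfClasses c P := fun p p' h hp => (hPω p').2 (h ▸ (hPω p).1 hp)
  have hinl : ∀ {z z' : V ⊕ ↥P}, c (vertexEnds z) = c (vertexEnds z') →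
      (∃ u, z = Sum.inl u) → ∃ u, z' = Sum.inl u := fun h hz =>
    (exists_inl_iff hPne _).2 ((hcc.eq_iff h).1 ((exists_inl_iff hPne _).1 hz))
  have hinr : ∀ {p : ↥P} {z' : V ⊕ ↥P}, c (vertexEnds (Sum.inr p)) = c (vertexEnds z') →
      ∃ p' : ↥P, z' = Sum.inr p' := by
    rintro p (u | p') h
    · obtain ⟨v, hv⟩ := hinl h.symm ⟨u, rfl⟩
      exact absurd hv (by simp)
    · exact ⟨p', rfl⟩
  have hcoh : IsCoherent (endsColouring P c) := endsColouring_isCoherent hcc hs hx hPc hPu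
  have href : RefinesFamily (endsColouring P c) (lift '' A ∪ {Eleft, Eright} ∪ Dfam) := by
    refine RefinesFamily.of_mem ?_
    rintro E hE ⟨z, w⟩ ⟨z', w'⟩ h hm
    obtain ⟨⟨e1, e2⟩, ⟨e3, -⟩, -, e6⟩ := endsColouring_eq_iff.1 h
    rcases hE with (⟨E, hE, rfl⟩ | rfl | rfl) | hE
    · rw [hlift] at hm ⊢
      obtain ⟨u, v, hq, hm⟩ := hm
      obtain ⟨rfl, rfl⟩ := Prod.mk.inj hq
      obtain ⟨u', rfl⟩ := hinl e1 ⟨u, rfl⟩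
      obtain ⟨v', rfl⟩ := hinl e2 ⟨v, rfl⟩
      exact ⟨u', v', rfl, hcA.mem hE e3 hm⟩
    · rw [hEleft] at hm ⊢
      obtain ⟨p, hq⟩ := hm
      obtain ⟨rfl, rfl⟩ := Prod.mk.inj hq
      obtain ⟨u', rfl⟩ := hinl e1 ⟨_, rfl⟩
      obtain ⟨p', rfl⟩ := hinr e2
      have hu : u' = (p' : V × V).1 := (hcc.eq_iff e3).1 rfl
      exact ⟨p', by rw [hu]⟩
    · rw [hEright] at hm ⊢
      obtain ⟨p, hq⟩ := hm
      obtain ⟨rfl, rfl⟩ := Prod.mk.inj hq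
      obtain ⟨u', rfl⟩ := hinl e1 ⟨_, rfl⟩
      obtain ⟨p', rfl⟩ := hinr e2
      have hu : u' = (p' : V × V).2 := (hcc.eq_iff e6).1 rfl
      exact ⟨p', by rw [hu]⟩
    · rw [hDfam] at hE
      obtain ⟨a, -, rfl⟩ := hE
      obtain ⟨p, hq, rfl⟩ := hm
      obtain ⟨rfl, rfl⟩ := Prod.mk.inj hq
      obtain ⟨p', rfl⟩ := hinr e1
      obtain rfl := (hcoh.eq_iff h).1 rfl
      exact ⟨p', rfl, e1.symm⟩
  have hloop : ∀ (u : V) (p : ↥P),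
      c' (Sum.inl u, Sum.inl u) ≠ c' (Sum.inr p, Sum.inr p) := by
    intro u p h
    have hD : {q : (V ⊕ ↥P) × (V ⊕ ↥P) | ∃ p' : ↥P, q = (Sum.inr p', Sum.inr p') ∧
        c (p' : V × V) = c (p : V × V)} ∈ lift '' A ∪ {Eleft, Eright} ∪ Dfam :=
      Or.inr (hDfam ▸ ⟨_, (hPω _).1 p.2, rfl⟩)
    obtain ⟨p', hq, -⟩ := hcA'.mem hD h.symm ⟨p, rfl, rfl⟩
    simp at hq
  have hrefV : RefinesFamily (fun p : V × V =>
      c' ((Sum.inl p.1 : V ⊕ ↥P), (Sum.inl p.2 : V ⊕ ↥P))) A := by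
    refine RefinesFamily.of_mem ?_
    rintro E hE ⟨u, v⟩ ⟨u', v'⟩ h hm
    have hE' : lift E ∈ lift '' A ∪ {Eleft, Eright} ∪ Dfam := Or.inl (Or.inl ⟨E, hE, rfl⟩)
    have hm' := hcA'.mem hE' h (by rw [hlift]; exact ⟨u, v, rfl, hm⟩)
    rw [hlift] at hm'
    obtain ⟨x, y, hq, hxy⟩ := hm'
    simp only [Prod.mk.injEq, Sum.inl.injEq] at hq
    rwa [hq.1, hq.2]
  intro u v u' v'
  constructor
  · intro h
    exact hmin' _ _ hcoh href _ _ (endsColouring_eq_iff.2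
      ⟨⟨hcc.diag_left_s17 h, hcc.diag_right_s17 h⟩, ⟨h, h⟩, h, h⟩)
  · intro h
    exact hmin _ _ (hcc'.restrict_inl hloop) hrefV (u, v) (u', v') h
end
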